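/- arXiv:2308.00460 — 3 statements merged into one kernel-verified Lean document; each statement's English description precedes it below -/
import Mathlib

section
/- Let X and Y be independent random variables, each having the standard Lévy distribution. Then E[1/(X+Y)] = 1/4, and consequently E[8/(X+Y) + 1/X + 1/Y] = 4. -/
open MeasureTheory Set ProbabilityTheory

/-- The density of the Lévy distribution with scale parameter `l`, extended by `0` off `(0,∞)`. -/
noncomputable def levyPDF (l x : ℝ) : ℝ :=
  if 0 < x then Real.sqrt (l / (2 * Real.pi)) * Real.exp (-(l / (2 * x))) * x ^ (-(3:ℝ)/2) else 0

/-- The Lévy distribution with scale parameter `l`, as a measure on `ℝ`. -/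
noncomputable def levyMeasure (l : ℝ) : Measure ℝ :=
  volume.withDensity (fun x => ENNReal.ofReal (levyPDF l x))

lemma measurable_levyPDF (l : ℝ) : Measurable (levyPDF l) := by
  unfold levyPDF
  exact Measurable.ite measurableSet_Ioi (by fun_prop) measurable_const

lemma levyPDF_nonneg (l x : ℝ) : 0 ≤ levyPDF l x := by
  unfold levyPDF
  split_ifs <;> positivity

lemma integral_levyMeasure (l : ℝ) (f : ℝ → ℝ) :
    ∫ x, f x ∂levyMeasure l = ∫ x, levyPDF l x * f x := by
  rw [levyMeasure, integral_withDensity_eq_integral_toReal_smul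
    (measurable_levyPDF l).ennreal_ofReal (ae_of_all _ fun _ ↦ ENNReal.ofReal_lt_top)]
  simp [ENNReal.toReal_ofReal (levyPDF_nonneg l _)]

lemma levyPDF_rpow_neg_two {z : ℝ} (hz : 0 < z) :
    |(-2 : ℝ)| * z ^ (-2 - 1 : ℝ) * levyPDF 1 (z ^ (-2 : ℝ)) = 2 * gaussianPDFReal 0 1 z := by
  have h : (z ^ (-2 : ℝ)) ^ (-(3 : ℝ) / 2) = z ^ (3 : ℝ) := by
    rw [← Real.rpow_mul hz.le]; norm_num
  have h' : z ^ (-2 - 1 : ℝ) * z ^ (3 : ℝ) = 1 := by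
    rw [← Real.rpow_add hz]; norm_num
  have h'' : 1 / (2 * z ^ (-2 : ℝ)) = z ^ 2 / 2 := by
    rw [Real.rpow_neg hz.le, Real.rpow_two]
    field_simp
  rw [levyPDF, if_pos (by positivity), h, h'', gaussianPDFReal]
  simp only [sub_zero, NNReal.coe_one, mul_one, one_div, Real.sqrt_inv, abs_neg, Nat.abs_ofNat,
    neg_div]
  linear_combination 2 * (√(2 * Real.pi))⁻¹ * Real.exp (-(z ^ 2 / 2)) * h'

/-- The inverse square of a standard Gaussian variable has the standard Lévy distribution, in
integral form. -/
lemma integral_levyMeasure_one (f : ℝ → ℝ) :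
    ∫ x, f x ∂levyMeasure 1 = ∫ z, f ((z ^ 2)⁻¹) ∂gaussianReal 0 1 := by
  rw [integral_levyMeasure, integral_gaussianReal_eq_integral_smul one_ne_zero]
  have hL : ∫ x, levyPDF 1 x * f x = ∫ x in Ioi 0, levyPDF 1 x * f x := by
    refine (setIntegral_eq_integral_of_forall_compl_eq_zero fun x hx ↦ ?_).symm
    rw [levyPDF, if_neg (notMem_Ioi.1 hx).not_gt, zero_mul]
  have hR : ∫ z, gaussianPDFReal 0 1 z • f ((z ^ 2)⁻¹) =
      2 * ∫ z in Ioi 0, gaussianPDFReal 0 1 z * f ((z ^ 2)⁻¹) := by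
    rw [← integral_comp_abs (f := fun z ↦ gaussianPDFReal 0 1 z * f ((z ^ 2)⁻¹))]
    simp [gaussianPDFReal]
  rw [hL, hR, ← integral_comp_rpow_Ioi _ (show (-2 : ℝ) ≠ 0 by norm_num), ← integral_const_mul]
  refine setIntegral_congr_fun measurableSet_Ioi fun z (hz : 0 < z) ↦ ?_
  have hz2 : z ^ (-2 : ℝ) = (z ^ 2)⁻¹ := by rw [Real.rpow_neg hz.le, Real.rpow_two]
  simp only [smul_eq_mul]
  rw [← mul_assoc, levyPDF_rpow_neg_two hz, hz2, mul_assoc]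

instance isFiniteMeasure_levyMeasure_one : IsFiniteMeasure (levyMeasure 1) := by
  have h : ∫ _, (1 : ℝ) ∂levyMeasure 1 = 1 := by simp [integral_levyMeasure_one fun _ ↦ 1]
  have h' := Integrable.of_integral_ne_zero (h.trans_ne one_ne_zero)
  simpa [integrable_const_iff] using h'

lemma levyMeasure_one_eq_map :
    levyMeasure 1 = (gaussianReal 0 1).map fun z ↦ (z ^ 2)⁻¹ := by
  refine Measure.ext fun s hs ↦ (measureReal_eq_measureReal_iff).1 ?_
  have hm : Measurable fun z : ℝ ↦ (z ^ 2)⁻¹ := by fun_prop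
  rw [← integral_indicator_one hs, ← integral_indicator_one hs, integral_levyMeasure_one,
    integral_map hm.aemeasurable
      (measurable_one.indicator hs).aestronglyMeasurable]

lemma integral_one_div_levyMeasure_one : ∫ x, 1 / x ∂levyMeasure 1 = 1 := by
  have h := variance_of_integral_eq_zero (X := id) (μ := gaussianReal 0 1) aemeasurable_id
    (by simp)
  rw [variance_id_gaussianReal] at h
  rw [integral_levyMeasure_one]
  simpa using h.symm

lemma integral_prod_gaussianReal (f : ℝ × ℝ → ℝ) :
    ∫ p, f p ∂(gaussianReal 0 1).prod (gaussianReal 0 1) =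
      ∫ p : ℝ × ℝ, gaussianPDFReal 0 1 p.1 * gaussianPDFReal 0 1 p.2 * f p := by
  rw [gaussianReal_of_var_ne_zero _ one_ne_zero,
    prod_withDensity (measurable_gaussianPDF _ _) (measurable_gaussianPDF _ _),
    integral_withDensity_eq_integral_toReal_smul (by fun_prop)
      (ae_of_all _ fun _ ↦ ENNReal.mul_lt_top gaussianPDF_lt_top gaussianPDF_lt_top)]
  simp [← Measure.volume_eq_prod]

lemma integral_pow_three_mul_exp_neg_sq_div_two :
    ∫ r in Ioi (0 : ℝ), r ^ 3 * Real.exp (-r ^ 2 / 2) = 2 := by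
  have h := integral_rpow_mul_exp_neg_mul_rpow (p := 2) (q := 3) (b := 1 / 2)
    (by norm_num) (by norm_num) (by norm_num)
  have hΓ : Real.Gamma 2 = 1 := by simp
  norm_num [hΓ] at h
  refine (setIntegral_congr_fun measurableSet_Ioi fun r _ ↦ ?_).trans h
  congr 2
  ring

lemma integral_cos_sq_mul_sin_sq_Ioo :
    ∫ θ in Ioo (-Real.pi) Real.pi, Real.cos θ ^ 2 * Real.sin θ ^ 2 = Real.pi / 4 := by
  rw [← integral_Ioc_eq_integral_Ioo,
    ← intervalIntegral.integral_of_le (by linarith [Real.pi_pos])]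
  simp_rw [mul_comm (Real.cos _ ^ 2)]
  rw [integral_sin_sq_mul_cos_sq]
  have h : Real.sin (4 * Real.pi) = 0 := by simpa using Real.sin_nat_mul_pi 4
  rw [mul_neg, Real.sin_neg, h]
  ring

lemma integral_sq_mul_sq_div_prod_gaussianReal :
    ∫ p : ℝ × ℝ, p.1 ^ 2 * p.2 ^ 2 / (p.1 ^ 2 + p.2 ^ 2)
      ∂(gaussianReal 0 1).prod (gaussianReal 0 1) = 1 / 4 := by
  have hπ := Real.pi_pos
  rw [integral_prod_gaussianReal, ← integral_comp_polarCoord_symm, polarCoord_target]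
  have key : ∀ p ∈ Ioi (0 : ℝ) ×ˢ Ioo (-Real.pi) Real.pi,
      p.1 • (gaussianPDFReal 0 1 (polarCoord.symm p).1 * gaussianPDFReal 0 1 (polarCoord.symm p).2 *
        ((polarCoord.symm p).1 ^ 2 * (polarCoord.symm p).2 ^ 2 /
          ((polarCoord.symm p).1 ^ 2 + (polarCoord.symm p).2 ^ 2))) =
      (2 * Real.pi)⁻¹ * ((p.1 ^ 3 * Real.exp (-p.1 ^ 2 / 2)) *
        (Real.cos p.2 ^ 2 * Real.sin p.2 ^ 2)) := by
    rintro ⟨r, θ⟩ ⟨hr : 0 < r, -⟩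
    have hsq : (r * Real.cos θ) ^ 2 + (r * Real.sin θ) ^ 2 = r ^ 2 := by
      linear_combination r ^ 2 * Real.cos_sq_add_sin_sq θ
    have hexp : Real.exp (-(r * Real.cos θ) ^ 2 / 2) * Real.exp (-(r * Real.sin θ) ^ 2 / 2) =
        Real.exp (-r ^ 2 / 2) := by
      rw [← Real.exp_add, ← hsq]
      congr 1
      ring
    have hsqrt : (√(2 * Real.pi))⁻¹ * (√(2 * Real.pi))⁻¹ = (2 * Real.pi)⁻¹ := by
      rw [← mul_inv, Real.mul_self_sqrt (by positivity)]
    simp only [polarCoord_symm_apply, gaussianPDFReal, sub_zero, NNReal.coe_one, mul_one,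
      smul_eq_mul]
    rw [hsq, mul_mul_mul_comm, hsqrt, hexp]
    field_simp
  rw [setIntegral_congr_fun (measurableSet_Ioi.prod measurableSet_Ioo) key, integral_const_mul,
    Measure.volume_eq_prod, setIntegral_prod_mul (fun r : ℝ ↦ r ^ 3 * Real.exp (-r ^ 2 / 2))
      (fun θ ↦ Real.cos θ ^ 2 * Real.sin θ ^ 2),
    integral_pow_three_mul_exp_neg_sq_div_two, integral_cos_sq_mul_sin_sq_Ioo]
  field_simp

lemma integral_one_div_add_prod_levyMeasure_one :
    ∫ p : ℝ × ℝ, 1 / (p.1 + p.2) ∂(levyMeasure 1).prod (levyMeasure 1) = 1 / 4 := by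
  have hm : Measurable fun z : ℝ ↦ (z ^ 2)⁻¹ := by fun_prop
  have hne : ∀ᵐ z ∂gaussianReal 0 1, z ≠ 0 := by
    have := nullSingletonClass_gaussianReal (μ := 0) (v := 1) one_ne_zero
    simp [ae_iff]
  rw [levyMeasure_one_eq_map, Measure.map_prod_map _ _ hm hm,
    integral_map (hm.prodMap hm).aemeasurable
      (Measurable.aestronglyMeasurable (by fun_prop)),
    ← integral_sq_mul_sq_div_prod_gaussianReal]
  refine integral_congr_ae ?_
  filter_upwards [Measure.quasiMeasurePreserving_fst.ae hne,
    Measure.quasiMeasurePreserving_snd.ae hne] with p h₁ h₂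
  simp only [Prod.map_fst, Prod.map_snd]
  field_simp
  ring

/-- If `X, Y` are independent standard Lévy random variables, then `E[1/(X+Y)] = 1/4` and
consequently `E[8/(X+Y) + 1/X + 1/Y] = 4`. -/
theorem levy_sum_inverse_moment {Ω : Type*} [MeasurableSpace Ω] (μ : Measure Ω)
    [IsProbabilityMeasure μ] (X Y : Ω → ℝ)
    (hindep : IndepFun X Y μ)
    (hX : Measure.map X μ = levyMeasure 1) (hY : Measure.map Y μ = levyMeasure 1) :
    (∫ ω, 1 / (X ω + Y ω) ∂μ) = 1 / 4 ∧
    (∫ ω, (8 / (X ω + Y ω) + 1 / X ω + 1 / Y ω) ∂μ) = 4 := by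
  have h0 : levyMeasure 1 ≠ 0 := by
    intro h
    simpa [h] using integral_one_div_levyMeasure_one
  have hXm : AEMeasurable X μ := .of_map_ne_zero (hX ▸ h0)
  have hYm : AEMeasurable Y μ := .of_map_ne_zero (hY ▸ h0)
  have hsum : ∫ ω, 1 / (X ω + Y ω) ∂μ = 1 / 4 := by
    rw [← integral_one_div_add_prod_levyMeasure_one]
    nth_rw 1 [← hX]
    rw [← hY, ← hindep.map_prod_eq_prod_map_map hXm hYm, integral_map (hXm.prodMk hYm)
      (Measurable.aestronglyMeasurable (by fun_prop))]
  have hinv : ∀ Z : Ω → ℝ, AEMeasurable Z μ → Measure.map Z μ = levyMeasure 1 →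
      ∫ ω, 1 / Z ω ∂μ = 1 := by
    intro Z hZm hZ
    have h := integral_one_div_levyMeasure_one
    rwa [← hZ, integral_map hZm (Measurable.aestronglyMeasurable (by fun_prop))] at h
  have hX1 := hinv X hXm hX
  have hY1 := hinv Y hYm hY
  have hsum_int : Integrable (fun ω ↦ 8 * (1 / (X ω + Y ω))) μ :=
    (Integrable.of_integral_ne_zero (hsum.trans_ne (by norm_num))).const_mul 8
  have hX_int := Integrable.of_integral_ne_zero (hX1.trans_ne one_ne_zero)
  have hY_int := Integrable.of_integral_ne_zero (hY1.trans_ne one_ne_zero)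
  refine ⟨hsum, ?_⟩
  have h8 : ∀ ω, 8 / (X ω + Y ω) = 8 * (1 / (X ω + Y ω)) := fun ω ↦ div_eq_mul_one_div _ _
  simp_rw [h8]
  rw [integral_add (by fun_prop) hY_int, integral_add hsum_int hX_int,
    integral_const_mul, hsum, hX1, hY1]
  norm_num
end

section
/- Fix a > 0 and t ∈ (0,1), and define the symmetric kernel Ψ(x,y;t,a) = t^a · (−log t)^{3/2} · ((t^x + t^y)/2 − t^{(x+y)/4}) for x, y > 0. If Y has the standard Lévy distribution, then for every x > 0, E[Ψ(x, Y; t, a)] = ∫₀^∞ Ψ(x,y;t,a) f₀(y) dy = (1/2) · t^a · (−log t)^{3/2} · (−2 t^{x/4} e^{−√(−log t)/√2} + t^x + e^{−√2 · √(−log t)}). -/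
open MeasureTheory Set

/-- The density of the standard Lévy distribution, for `x > 0`. -/
noncomputable def stdLevyPDF (x : ℝ) : ℝ :=
  (1 / Real.sqrt (2 * Real.pi)) * Real.exp (-(1 / (2 * x))) * x ^ (-(3:ℝ)/2)

/-- The symmetric kernel `Ψ(x,y;t,a) = t^a (-log t)^{3/2} ((t^x + t^y)/2 - t^{(x+y)/4})`. -/
noncomputable def levyKernelPsi (t a x y : ℝ) : ℝ :=
  t ^ a * (-Real.log t) ^ ((3:ℝ)/2) * ((t ^ x + t ^ y) / 2 - t ^ ((x + y) / 4))

open Filter Topology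

/-- The fundamental theorem of calculus on `(a, ∞)` for a nonnegative derivative, assuming only
one-sided limits of the primitive at both ends. -/
theorem integral_Ioi_of_hasDerivAt_of_nonneg_of_tendsto {g g' : ℝ → ℝ} {a l₀ l : ℝ}
    (hderiv : ∀ x ∈ Ioi a, HasDerivAt g (g' x) x) (hpos : ∀ x ∈ Ioi a, 0 ≤ g' x)
    (h₀ : Tendsto g (𝓝[>] a) (𝓝 l₀)) (h : Tendsto g atTop (𝓝 l)) :
    IntegrableOn g' (Ioi a) ∧ ∫ x in Ioi a, g' x = l - l₀ := by
  have hne : ∀ x ∈ Ioi a, Function.update g a l₀ =ᶠ[𝓝 x] g := fun x hx ↦ by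
    filter_upwards [Ioi_mem_nhds hx] with y hy
    exact Function.update_of_ne (ne_of_gt hy) _ _
  have hcont : ContinuousWithinAt (Function.update g a l₀) (Ici a) a := by
    rw [continuousWithinAt_update_same, Ici_sdiff_left]
    exact h₀
  have hderiv' : ∀ x ∈ Ioi a, HasDerivAt (Function.update g a l₀) (g' x) x :=
    fun x hx ↦ (hderiv x hx).congr_of_eventuallyEq (hne x hx)
  have htop : Tendsto (Function.update g a l₀) atTop (𝓝 l) := by
    refine h.congr' ?_
    filter_upwards [Ioi_mem_atTop a] with y hy
    exact (Function.update_of_ne (ne_of_gt hy) _ _).symm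
  refine ⟨integrableOn_Ioi_deriv_of_nonneg hcont hderiv' hpos htop, ?_⟩
  simpa using integral_Ioi_of_hasDerivAt_of_nonneg hcont hderiv' hpos htop

/-- The odd primitive of the unnormalised standard Gaussian density. -/
noncomputable def gaussianPrimitive (z : ℝ) : ℝ :=
  ∫ v in (0:ℝ)..z, Real.exp (-(1 / 2) * v ^ 2)

theorem hasDerivAt_gaussianPrimitive (z : ℝ) :
    HasDerivAt gaussianPrimitive (Real.exp (-(1 / 2) * z ^ 2)) z :=
  (Continuous.integral_hasStrictDerivAt (by fun_prop) 0 z).hasDerivAt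

theorem gaussianPrimitive_neg (z : ℝ) : gaussianPrimitive (-z) = -gaussianPrimitive z := by
  have h := intervalIntegral.integral_comp_neg (a := 0) (b := z)
    (fun v : ℝ ↦ Real.exp (-(1 / 2) * v ^ 2))
  simp only [neg_sq, neg_zero] at h
  rw [gaussianPrimitive, gaussianPrimitive, h, intervalIntegral.integral_symm]

theorem tendsto_gaussianPrimitive_atTop :
    Tendsto gaussianPrimitive atTop (𝓝 (√(2 * Real.pi) / 2)) := by
  have h := intervalIntegral_tendsto_integral_Ioi 0
    (integrable_exp_neg_mul_sq (b := 1 / 2) (by norm_num)).integrableOn tendsto_id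
  rw [integral_gaussian_Ioi, show Real.pi / (1 / 2) = 2 * Real.pi by ring] at h
  exact h

theorem tendsto_gaussianPrimitive_atBot :
    Tendsto gaussianPrimitive atBot (𝓝 (-(√(2 * Real.pi) / 2))) := by
  refine (tendsto_gaussianPrimitive_atTop.comp tendsto_neg_atBot_atTop).neg.congr fun z ↦ ?_
  simp [gaussianPrimitive_neg]

/-- A primitive on `(0, ∞)` of the Lévy density tilted by `exp (-(c ^ 2 / 2 * y))`. -/
noncomputable def tiltedLevyPrimitive (c y : ℝ) : ℝ :=
  -(1 / √(2 * Real.pi) * (Real.exp (-c) * gaussianPrimitive ((√y)⁻¹ - c * √y)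
    + Real.exp c * gaussianPrimitive ((√y)⁻¹ + c * √y)))

theorem stdLevyPDF_nonneg {y : ℝ} (hy : 0 < y) : 0 ≤ stdLevyPDF y := by
  unfold stdLevyPDF
  positivity

theorem hasDerivAt_tiltedLevyPrimitive (c : ℝ) {y : ℝ} (hy : 0 < y) :
    HasDerivAt (tiltedLevyPrimitive c) (Real.exp (-(c ^ 2 / 2 * y)) * stdLevyPDF y) y := by
  have hr : 0 < √y := Real.sqrt_pos.mpr hy
  have hsq : √y ^ 2 = y := Real.sq_sqrt hy.le
  have hpow : y ^ (-(3:ℝ)/2) = (√y ^ 3)⁻¹ := by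
    rw [Real.sqrt_eq_rpow, ← Real.rpow_natCast, ← Real.rpow_mul hy.le, ← Real.rpow_neg hy.le]
    norm_num
  have hs := Real.hasDerivAt_sqrt hy.ne'
  have hminus := (hasDerivAt_gaussianPrimitive ((√y)⁻¹ - c * √y)).comp y
    ((hs.inv hr.ne').sub (hs.const_mul c))
  have hplus := (hasDerivAt_gaussianPrimitive ((√y)⁻¹ + c * √y)).comp y
    ((hs.inv hr.ne').add (hs.const_mul c))
  have hexp_minus : Real.exp (-c) * Real.exp (-(1 / 2) * ((√y)⁻¹ - c * √y) ^ 2)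
      = Real.exp (-(c ^ 2 / 2 * y)) * Real.exp (-(1 / (2 * y))) := by
    rw [← Real.exp_add, ← Real.exp_add]
    congr 1
    nth_rw 3 4 [← hsq]
    field_simp
    ring
  have hexp_plus : Real.exp c * Real.exp (-(1 / 2) * ((√y)⁻¹ + c * √y) ^ 2)
      = Real.exp (-(c ^ 2 / 2 * y)) * Real.exp (-(1 / (2 * y))) := by
    rw [← Real.exp_add, ← Real.exp_add]
    congr 1
    nth_rw 3 4 [← hsq]
    field_simp
    ring
  refine (((hminus.const_mul (Real.exp (-c))).add (hplus.const_mul (Real.exp c))).const_mul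
    (1 / √(2 * Real.pi))).neg.congr_deriv ?_
  rw [← mul_assoc, ← mul_assoc, hexp_minus, hexp_plus, stdLevyPDF, hpow]
  field_simp
  ring

theorem tendsto_tiltedLevyPrimitive_zero (c : ℝ) :
    Tendsto (tiltedLevyPrimitive c) (𝓝[>] 0) (𝓝 (-((Real.exp (-c) + Real.exp c) / 2))) := by
  have hsqrt : Tendsto (fun y : ℝ ↦ √y) (𝓝[>] 0) (𝓝[>] 0) := by
    refine tendsto_nhdsWithin_iff.mpr ⟨?_, ?_⟩
    · simpa using (Real.continuous_sqrt.tendsto 0).mono_left nhdsWithin_le_nhds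
    · filter_upwards [self_mem_nhdsWithin] with y hy using Real.sqrt_pos.mpr hy
  have hinv : Tendsto (fun y : ℝ ↦ (√y)⁻¹) (𝓝[>] 0) atTop := tendsto_inv_nhdsGT_zero.comp hsqrt
  have hmul : Tendsto (fun y : ℝ ↦ c * √y) (𝓝[>] 0) (𝓝 (c * 0)) :=
    (hsqrt.mono_right nhdsWithin_le_nhds).const_mul c
  have hminus := tendsto_gaussianPrimitive_atTop.comp (hinv.atTop_add hmul.neg)
  have hplus := tendsto_gaussianPrimitive_atTop.comp (hinv.atTop_add hmul)
  have hlim := (((hminus.const_mul (Real.exp (-c))).add (hplus.const_mul (Real.exp c))).const_mul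
    (1 / √(2 * Real.pi))).neg
  have hpi : √(2 * Real.pi) ≠ 0 := by positivity
  have hval : -(1 / √(2 * Real.pi) * (Real.exp (-c) * (√(2 * Real.pi) / 2)
      + Real.exp c * (√(2 * Real.pi) / 2))) = -((Real.exp (-c) + Real.exp c) / 2) := by
    field_simp
  rw [hval] at hlim
  exact hlim

theorem tendsto_tiltedLevyPrimitive_atTop {c : ℝ} (hc : 0 ≤ c) :
    Tendsto (tiltedLevyPrimitive c) atTop
      (𝓝 (Real.exp (-c) - (Real.exp (-c) + Real.exp c) / 2)) := by
  have hinv : Tendsto (fun y : ℝ ↦ (√y)⁻¹) atTop (𝓝 0) :=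
    tendsto_inv_atTop_zero.comp Real.tendsto_sqrt_atTop
  rcases hc.eq_or_lt with rfl | hc
  · have hG : Tendsto (fun y : ℝ ↦ gaussianPrimitive (√y)⁻¹) atTop (𝓝 0) := by
      have h := (hasDerivAt_gaussianPrimitive 0).continuousAt.tendsto.comp hinv
      rwa [show gaussianPrimitive 0 = 0 by simp [gaussianPrimitive]] at h
    simpa [funext (tiltedLevyPrimitive.eq_1 0)] using ((hG.add hG).const_mul (1 / √(2 * Real.pi))).neg
  · have hmul : Tendsto (fun y : ℝ ↦ c * √y) atTop atTop :=
      Real.tendsto_sqrt_atTop.const_mul_atTop hc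
    have hminus := tendsto_gaussianPrimitive_atBot.comp
      (hinv.add_atBot (tendsto_neg_atTop_atBot.comp hmul))
    have hplus := tendsto_gaussianPrimitive_atTop.comp (hinv.add_atTop hmul)
    have hlim := (((hminus.const_mul (Real.exp (-c))).add
      (hplus.const_mul (Real.exp c))).const_mul (1 / √(2 * Real.pi))).neg
    have hpi : √(2 * Real.pi) ≠ 0 := by positivity
    have hval : -(1 / √(2 * Real.pi) * (Real.exp (-c) * -(√(2 * Real.pi) / 2)
        + Real.exp c * (√(2 * Real.pi) / 2)))
        = Real.exp (-c) - (Real.exp (-c) + Real.exp c) / 2 := by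
      field_simp
      ring
    rw [hval] at hlim
    exact hlim

/-- The Laplace transform of the standard Lévy distribution at `c ^ 2 / 2` is `exp (-c)`. -/
theorem laplace_stdLevyPDF {c : ℝ} (hc : 0 ≤ c) :
    IntegrableOn (fun y ↦ Real.exp (-(c ^ 2 / 2 * y)) * stdLevyPDF y) (Ioi 0) ∧
      ∫ y in Ioi (0:ℝ), Real.exp (-(c ^ 2 / 2 * y)) * stdLevyPDF y = Real.exp (-c) := by
  have h := integral_Ioi_of_hasDerivAt_of_nonneg_of_tendsto
    (fun y hy ↦ hasDerivAt_tiltedLevyPrimitive c hy)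
    (fun y hy ↦ mul_nonneg (Real.exp_pos _).le (stdLevyPDF_nonneg hy))
    (tendsto_tiltedLevyPrimitive_zero c) (tendsto_tiltedLevyPrimitive_atTop hc)
  refine ⟨h.1, h.2.trans ?_⟩
  ring

/-- The first projection of the kernel `Ψ`: if `Y` has the standard Lévy distribution, then
for every `x > 0`,
`E[Ψ(x,Y;t,a)] = (1/2) t^a (-log t)^{3/2} (-2 t^{x/4} e^{-√(-log t)/√2} + t^x + e^{-√2 √(-log t)})`. -/
theorem first_projection_of_kernel (a t : ℝ) (ha : 0 < a) (ht : t ∈ Set.Ioo (0:ℝ) 1)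
    (x : ℝ) (hx : 0 < x) :
    (∫ y in Set.Ioi (0:ℝ), levyKernelPsi t a x y * stdLevyPDF y)
      = (1/2) * t ^ a * (-Real.log t) ^ ((3:ℝ)/2) *
          (-2 * t ^ (x/4) * Real.exp (-(Real.sqrt (-Real.log t) / Real.sqrt 2)) + t ^ x
            + Real.exp (-(Real.sqrt 2 * Real.sqrt (-Real.log t)))) := by
  obtain ⟨ht₀, ht₁⟩ := ht
  have hs : 0 ≤ -Real.log t := by linarith [Real.log_neg ht₀ ht₁]
  have h2 : √(2:ℝ) ^ 2 = 2 := Real.sq_sqrt (by norm_num)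
  obtain ⟨hint_zero, hval_zero⟩ := laplace_stdLevyPDF le_rfl
  obtain ⟨hint_full, hval_full⟩ :=
    laplace_stdLevyPDF (c := √2 * √(-Real.log t)) (by positivity)
  obtain ⟨hint_quarter, hval_quarter⟩ :=
    laplace_stdLevyPDF (c := √(-Real.log t) / √2) (by positivity)
  have hfull : ∀ y : ℝ, Real.exp (-((√2 * √(-Real.log t)) ^ 2 / 2 * y)) = t ^ y := fun y ↦ by
    rw [Real.rpow_def_of_pos ht₀, mul_pow, h2, Real.sq_sqrt hs]
    ring_nf
  have hquarter : ∀ y : ℝ,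
      Real.exp (-((√(-Real.log t) / √2) ^ 2 / 2 * y)) = t ^ (y / 4) := fun y ↦ by
    rw [Real.rpow_def_of_pos ht₀, div_pow, h2, Real.sq_sqrt hs]
    ring_nf
  simp only [hfull] at hint_full hval_full
  simp only [hquarter] at hint_quarter hval_quarter
  simp only [ne_eq, OfNat.ofNat_ne_zero, not_false_eq_true, zero_pow, zero_div, zero_mul,
    neg_zero, Real.exp_zero, one_mul] at hint_zero hval_zero
  have hsplit : ∀ y : ℝ, levyKernelPsi t a x y * stdLevyPDF y
      = t ^ a * (-Real.log t) ^ ((3:ℝ)/2) * (t ^ x / 2 * stdLevyPDF y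
        + 1 / 2 * (t ^ y * stdLevyPDF y) - t ^ (x / 4) * (t ^ (y / 4) * stdLevyPDF y)) :=
    fun y ↦ by
      rw [levyKernelPsi, add_div x y 4, Real.rpow_add ht₀]
      ring
  simp only [hsplit]
  have hint_add : IntegrableOn (fun y ↦ t ^ x / 2 * stdLevyPDF y
      + 1 / 2 * (t ^ y * stdLevyPDF y)) (Ioi 0) :=
    (hint_zero.const_mul _).add (hint_full.const_mul _)
  rw [integral_const_mul, integral_sub hint_add (hint_quarter.const_mul _),
    integral_add (hint_zero.const_mul _) (hint_full.const_mul _),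
    integral_const_mul, integral_const_mul, integral_const_mul, hval_zero, hval_full,
    hval_quarter]
  ring
end

section
/- Fix a > 0 and s, t ∈ (0,1), and write L_s = −log s, L_t = −log t. If X has the standard Lévy distribution, then the covariance function of the limiting Gaussian process of √n J_{n,a} satisfies K(s,t) = 4·∫₀^∞ ψ(x;s,a) ψ(x;t,a) f₀(x) dx = s^a t^a (L_s L_t)^{3/2} · (4 e^{−(√(L_s + L_t) + √(L_s) + √(L_t))/√2} − 2 e^{−√(2L_s + L_t/2) − √(L_t/2)} − 2 e^{−√(2L_t + L_s/2) − √(L_s/2)} + e^{−√(2(L_s + L_t))} − e^{−√(2L_s) − √(2L_t)}). -/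
open MeasureTheory Set

/-- The first projection `ψ(x;t,a)` of the kernel
`Ψ(x,y;t,a) = t^a (-log t)^{3/2} ((t^x + t^y)/2 - t^{(x+y)/4})`. -/
noncomputable def levyProjPsi (t a x : ℝ) : ℝ :=
  (1/2) * t ^ a * (-Real.log t) ^ ((3:ℝ)/2) *
    (-2 * t ^ (x/4) * Real.exp (-(Real.sqrt (-Real.log t) / Real.sqrt 2)) + t ^ x
      + Real.exp (-(Real.sqrt 2 * Real.sqrt (-Real.log t))))

open Filter Topology

/-- The improper fundamental theorem of calculus on `(a, ∞)` for a nonnegative derivative, with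
the value at `a` replaced by a right limit. -/
theorem integrableOn_and_integral_Ioi_of_hasDerivAt_of_nonneg {g g' : ℝ → ℝ} {a k l : ℝ}
    (hleft : Tendsto g (𝓝[>] a) (𝓝 k)) (hderiv : ∀ x ∈ Ioi a, HasDerivAt g (g' x) x)
    (hnonneg : ∀ x ∈ Ioi a, 0 ≤ g' x) (htop : Tendsto g atTop (𝓝 l)) :
    IntegrableOn g' (Ioi a) ∧ ∫ x in Ioi a, g' x = l - k := by
  have hcont : ContinuousWithinAt (Function.update g a k) (Ici a) a := by
    rwa [continuousWithinAt_update_same, Ici_sdiff_left]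
  have hderiv' : ∀ x ∈ Ioi a, HasDerivAt (Function.update g a k) (g' x) x := fun x hx =>
    (hderiv x hx).congr_of_eventuallyEq <| by
      filter_upwards [Ioi_mem_nhds hx] with y hy
      exact Function.update_of_ne (ne_of_gt hy) _ _
  have htop' : Tendsto (Function.update g a k) atTop (𝓝 l) := htop.congr' <| by
    filter_upwards [eventually_gt_atTop a] with y hy
    exact (Function.update_of_ne hy.ne' _ _).symm
  refine ⟨integrableOn_Ioi_deriv_of_nonneg hcont hderiv' hnonneg htop', ?_⟩
  simpa using integral_Ioi_of_hasDerivAt_of_nonneg hcont hderiv' hnonneg htop'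

/-- The unnormalized error function `∫₀ˣ e^{-u²/2} du`. -/
noncomputable def gaussPrimitive (x : ℝ) : ℝ := ∫ u in (0:ℝ)..x, Real.exp (-(1/2) * u ^ 2)

theorem hasDerivAt_gaussPrimitive (x : ℝ) :
    HasDerivAt gaussPrimitive (Real.exp (-(1/2) * x ^ 2)) x :=
  ((by fun_prop : Continuous fun u : ℝ => Real.exp (-(1/2) * u ^ 2)).integral_hasStrictDerivAt
    0 x).hasDerivAt

theorem gaussPrimitive_neg (x : ℝ) : gaussPrimitive (-x) = -gaussPrimitive x := by
  have h := intervalIntegral.integral_comp_neg (a := 0) (b := x)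
    (fun u : ℝ => Real.exp (-(1/2) * u ^ 2))
  simp only [neg_sq, neg_zero] at h
  rw [gaussPrimitive, gaussPrimitive, intervalIntegral.integral_symm, h]

theorem tendsto_gaussPrimitive_atTop :
    Tendsto gaussPrimitive atTop (𝓝 (Real.sqrt (2 * Real.pi) / 2)) := by
  have h := intervalIntegral_tendsto_integral_Ioi 0
    (integrable_exp_neg_mul_sq (b := 1/2) (by norm_num)).integrableOn tendsto_id
  rw [integral_gaussian_Ioi] at h
  rw [show 2 * Real.pi = Real.pi / (1 / 2) by ring]
  exact h

theorem tendsto_gaussPrimitive_atBot :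
    Tendsto gaussPrimitive atBot (𝓝 (-(Real.sqrt (2 * Real.pi) / 2))) := by
  refine (tendsto_gaussPrimitive_atTop.comp tendsto_neg_atBot_atTop).neg.congr fun x => ?_
  simp [gaussPrimitive_neg]

/-- A primitive on `(0, ∞)` of `x ↦ e^{-c²x/2} e^{-1/(2x)} x^{-3/2}`. -/
noncomputable def invGaussPrimitive (c x : ℝ) : ℝ :=
  Real.exp (-c) * gaussPrimitive (c * Real.sqrt x - (Real.sqrt x)⁻¹) +
    Real.exp c * gaussPrimitive (-c * Real.sqrt x - (Real.sqrt x)⁻¹)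

theorem hasDerivAt_invGaussPrimitive (c : ℝ) {x : ℝ} (hx : 0 < x) :
    HasDerivAt (invGaussPrimitive c)
      (Real.exp (-(c ^ 2 / 2 * x)) * (Real.exp (-(1 / (2 * x))) * x ^ (-(3:ℝ)/2))) x := by
  have hw : 0 < Real.sqrt x := Real.sqrt_pos.2 hx
  have hsq : Real.sqrt x ^ 2 = x := Real.sq_sqrt hx.le
  have hpow : x ^ (-(3:ℝ)/2) = (Real.sqrt x ^ 3)⁻¹ := by
    rw [neg_div, Real.rpow_neg hx.le, Real.sqrt_eq_rpow, ← Real.rpow_natCast, ← Real.rpow_mul hx.le]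
    norm_num
  have hroot := Real.hasDerivAt_sqrt hx.ne'
  have harg (b : ℝ) := (hroot.const_mul b).sub (hroot.inv hw.ne')
  have hterm (b : ℝ) := ((hasDerivAt_gaussPrimitive _).comp x (harg b)).const_mul (Real.exp (-b))
  have hexp (b : ℝ) : Real.exp (-b) * Real.exp (-(1/2) * (b * Real.sqrt x - (Real.sqrt x)⁻¹) ^ 2)
      = Real.exp (-(b ^ 2 / 2 * x)) * Real.exp (-(1 / (2 * x))) := by
    rw [← Real.exp_add, ← Real.exp_add]
    congr 1
    rw [← hsq, Real.sqrt_sq hw.le]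
    field_simp
    ring
  have h := (hterm c).add (hterm (-c))
  rw [neg_neg] at h
  have hexp' := hexp (-c)
  rw [neg_neg, neg_sq] at hexp'
  refine h.congr_deriv ?_
  simp only [Pi.sub_apply, Pi.inv_apply]
  rw [← mul_assoc, ← mul_assoc, hexp c, hexp', hpow]
  field_simp
  ring

theorem tendsto_invGaussPrimitive_zero (c : ℝ) :
    Tendsto (invGaussPrimitive c) (𝓝[>] 0)
      (𝓝 (Real.exp (-c) * -(Real.sqrt (2 * Real.pi) / 2) +
        Real.exp c * -(Real.sqrt (2 * Real.pi) / 2))) := by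
  have hroot : Tendsto Real.sqrt (𝓝[>] 0) (𝓝 0) := by
    simpa using (Real.continuous_sqrt.tendsto 0).mono_left nhdsWithin_le_nhds
  have hinv : Tendsto (fun x => (Real.sqrt x)⁻¹) (𝓝[>] 0) atTop :=
    tendsto_inv_nhdsGT_zero.comp <| tendsto_nhdsWithin_iff.2 ⟨hroot, by
      filter_upwards [self_mem_nhdsWithin] with x hx using Real.sqrt_pos.2 hx⟩
  have harg (b : ℝ) : Tendsto (fun x => b * Real.sqrt x - (Real.sqrt x)⁻¹) (𝓝[>] 0) atBot := by
    simpa only [sub_eq_add_neg, Function.comp_def] using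
      (hroot.const_mul b).add_atBot (tendsto_neg_atTop_atBot.comp hinv)
  have hlim (b : ℝ) := tendsto_gaussPrimitive_atBot.comp (harg b)
  exact ((hlim c).const_mul (Real.exp (-c))).add ((hlim (-c)).const_mul (Real.exp c))

theorem tendsto_invGaussPrimitive_atTop {c : ℝ} (hc : 0 ≤ c) :
    Tendsto (invGaussPrimitive c) atTop
      (𝓝 (Real.exp (-c) * (Real.sqrt (2 * Real.pi) / 2) +
        Real.exp c * -(Real.sqrt (2 * Real.pi) / 2))) := by
  have hinv : Tendsto (fun x => (Real.sqrt x)⁻¹) atTop (𝓝 0) :=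
    tendsto_inv_atTop_zero.comp Real.tendsto_sqrt_atTop
  rcases hc.eq_or_lt with rfl | hc
  · have hzero : gaussPrimitive 0 = 0 := by simp [gaussPrimitive]
    have harg : Tendsto (fun x => gaussPrimitive (-(Real.sqrt x)⁻¹)) atTop (𝓝 0) := by
      have h := (hasDerivAt_gaussPrimitive 0).continuousAt.tendsto
      rw [hzero] at h
      exact h.comp (by simpa using hinv.neg)
    have h := harg.add harg
    rw [add_zero] at h
    have hfun : invGaussPrimitive 0 =
        fun x => gaussPrimitive (-(Real.sqrt x)⁻¹) + gaussPrimitive (-(Real.sqrt x)⁻¹) := by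
      funext x
      simp [invGaussPrimitive]
    simpa [hfun] using h
  · have htop : Tendsto (fun x => c * Real.sqrt x - (Real.sqrt x)⁻¹) atTop atTop := by
      simpa only [sub_eq_add_neg] using
        (Real.tendsto_sqrt_atTop.const_mul_atTop hc).atTop_add hinv.neg
    have hbot : Tendsto (fun x => -c * Real.sqrt x - (Real.sqrt x)⁻¹) atTop atBot := by
      simpa only [sub_eq_add_neg] using
        (Real.tendsto_sqrt_atTop.const_mul_atTop_of_neg (neg_neg_of_pos hc)).atBot_add hinv.neg
    exact ((tendsto_gaussPrimitive_atTop.comp htop).const_mul (Real.exp (-c))).add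
      ((tendsto_gaussPrimitive_atBot.comp hbot).const_mul (Real.exp c))

/-- The Laplace transform of the standard Lévy distribution. -/
theorem integrableOn_and_integral_exp_mul_stdLevyPDF {l : ℝ} (hl : 0 ≤ l) :
    IntegrableOn (fun x => Real.exp (-(l * x)) * stdLevyPDF x) (Ioi 0) ∧
      ∫ x in Ioi (0:ℝ), Real.exp (-(l * x)) * stdLevyPDF x = Real.exp (-Real.sqrt (2 * l)) := by
  have hsq : Real.sqrt (2 * l) ^ 2 / 2 = l := by
    rw [Real.sq_sqrt (by positivity)]
    ring
  obtain ⟨hint, heq⟩ := integrableOn_and_integral_Ioi_of_hasDerivAt_of_nonneg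
    (tendsto_invGaussPrimitive_zero (Real.sqrt (2 * l)))
    (fun x hx => hasDerivAt_invGaussPrimitive _ hx)
    (fun x hx => by have : 0 < x := hx; positivity)
    (tendsto_invGaussPrimitive_atTop (Real.sqrt_nonneg (2 * l)))
  rw [hsq] at hint heq
  have hfun : (fun x => Real.exp (-(l * x)) * stdLevyPDF x) = fun x => 1 / Real.sqrt (2 * Real.pi) *
      (Real.exp (-(l * x)) * (Real.exp (-(1 / (2 * x))) * x ^ (-(3:ℝ)/2))) := by
    funext x
    rw [stdLevyPDF]
    ring
  have hpi : 0 < Real.sqrt (2 * Real.pi) := by positivity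
  rw [hfun]
  refine ⟨hint.const_mul _, ?_⟩
  rw [integral_const_mul, heq]
  field_simp
  ring

/-- The covariance function of the limiting Gaussian process of `√n J_{n,a}`: with
`L_s = -log s`, `L_t = -log t`,
`K(s,t) = 4 E[ψ(X;s,a) ψ(X;t,a)]
  = s^a t^a (L_s L_t)^{3/2} (4 e^{-(√(L_s+L_t)+√L_s+√L_t)/√2} - 2 e^{-√(2L_s+L_t/2)-√(L_t/2)}
      - 2 e^{-√(2L_t+L_s/2)-√(L_s/2)} + e^{-√(2(L_s+L_t))} - e^{-√(2L_s)-√(2L_t)})`. -/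
theorem covariance_of_limit_process (a s t : ℝ) (ha : 0 < a)
    (hs : s ∈ Set.Ioo (0:ℝ) 1) (ht : t ∈ Set.Ioo (0:ℝ) 1)
    (Ls Lt : ℝ) (hLs : Ls = -Real.log s) (hLt : Lt = -Real.log t) :
    4 * (∫ x in Set.Ioi (0:ℝ), levyProjPsi s a x * levyProjPsi t a x * stdLevyPDF x)
      = s ^ a * t ^ a * (Ls * Lt) ^ ((3:ℝ)/2) *
          (4 * Real.exp (-((Real.sqrt (Ls + Lt) + Real.sqrt Ls + Real.sqrt Lt) / Real.sqrt 2))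
            - 2 * Real.exp (-Real.sqrt (2*Ls + Lt/2) - Real.sqrt (Lt/2))
            - 2 * Real.exp (-Real.sqrt (2*Lt + Ls/2) - Real.sqrt (Ls/2))
            + Real.exp (-Real.sqrt (2*(Ls + Lt)))
            - Real.exp (-Real.sqrt (2*Ls) - Real.sqrt (2*Lt))) := by
  obtain ⟨hs0, hs1⟩ := hs
  obtain ⟨ht0, ht1⟩ := ht
  have hLs0 : 0 < Ls := hLs ▸ neg_pos.2 (Real.log_neg hs0 hs1)
  have hLt0 : 0 < Lt := hLt ▸ neg_pos.2 (Real.log_neg ht0 ht1)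
  have hspow (x : ℝ) : s ^ x = Real.exp (-(Ls * x)) := by
    rw [Real.rpow_def_of_pos hs0, hLs, neg_mul, neg_neg]
  have htpow (x : ℝ) : t ^ x = Real.exp (-(Lt * x)) := by
    rw [Real.rpow_def_of_pos ht0, hLt, neg_mul, neg_neg]
  have hdiv (L : ℝ) : Real.sqrt L / Real.sqrt 2 = Real.sqrt (L / 2) :=
    (Real.sqrt_div' L (by norm_num)).symm
  have hmul (L : ℝ) : Real.sqrt 2 * Real.sqrt L = Real.sqrt (2 * L) :=
    (Real.sqrt_mul (by norm_num) L).symm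
  have hdouble (L : ℝ) :
      Real.exp (-Real.sqrt (2 * L)) = Real.exp (-Real.sqrt (L / 2)) ^ 2 := by
    rw [← Real.exp_nat_mul, show 2 * L = 2 ^ 2 * (L / 2) by ring, Real.sqrt_mul (by norm_num),
      Real.sqrt_sq (by norm_num)]
    push_cast
    ring_nf
  set A := Real.exp (-Real.sqrt (Ls / 2)) with hA
  set B := Real.exp (-Real.sqrt (Lt / 2)) with hB
  let e (l x : ℝ) : ℝ := Real.exp (-(l * x)) * stdLevyPDF x
  have hexpand (x : ℝ) : levyProjPsi s a x * levyProjPsi t a x * stdLevyPDF x =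
      1 / 4 * (s ^ a * t ^ a * (Ls * Lt) ^ ((3:ℝ)/2)) *
        (4 * A * B * e ((Ls + Lt) / 4) x - 2 * A * e (Ls / 4 + Lt) x - 2 * A * B ^ 2 * e (Ls / 4) x
          - 2 * B * e (Ls + Lt / 4) x + e (Ls + Lt) x + B ^ 2 * e Ls x
          - 2 * A ^ 2 * B * e (Lt / 4) x + A ^ 2 * e Lt x + A ^ 2 * B ^ 2 * e 0 x) := by
    have hsplit (l m : ℝ) :
        Real.exp (-((l + m) * x)) = Real.exp (-(l * x)) * Real.exp (-(m * x)) := by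
      rw [← Real.exp_add]
      ring_nf
    have hquarter (L : ℝ) : L * (x / 4) = L / 4 * x := by ring
    simp only [levyProjPsi, e, ← hLs, ← hLt, hdiv, hmul, hdouble, ← hA, ← hB, hspow (x / 4), hspow x,
      htpow (x / 4), htpow x, hquarter, add_div, hsplit, zero_mul, neg_zero, Real.exp_zero,
      Real.mul_rpow hLs0.le hLt0.le]
    ring
  have hint {l : ℝ} (hl : 0 ≤ l) : IntegrableOn (e l) (Ioi 0) :=
    (integrableOn_and_integral_exp_mul_stdLevyPDF hl).1
  have hval {l : ℝ} (hl : 0 ≤ l) : ∫ x in Ioi (0:ℝ), e l x = Real.exp (-Real.sqrt (2 * l)) :=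
    (integrableOn_and_integral_exp_mul_stdLevyPDF hl).2
  have hint_sum_div := hint (l := (Ls + Lt) / 4) (by positivity)
  have hint_div_add := hint (l := Ls / 4 + Lt) (by positivity)
  have hint_Ls_div := hint (l := Ls / 4) (by positivity)
  have hint_add_div := hint (l := Ls + Lt / 4) (by positivity)
  have hint_sum := hint (l := Ls + Lt) (by positivity)
  have hint_Ls := hint (l := Ls) (by positivity)
  have hint_Lt_div := hint (l := Lt / 4) (by positivity)
  have hint_Lt := hint (l := Lt) (by positivity)
  have hint_zero := hint (l := 0) (by positivity)
  unfold IntegrableOn at *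
  simp_rw [hexpand]
  rw [integral_const_mul, integral_add (by fun_prop) (by fun_prop),
    integral_add (by fun_prop) (by fun_prop), integral_sub (by fun_prop) (by fun_prop),
    integral_add (by fun_prop) (by fun_prop), integral_add (by fun_prop) (by fun_prop),
    integral_sub (by fun_prop) (by fun_prop), integral_sub (by fun_prop) (by fun_prop),
    integral_sub (by fun_prop) (by fun_prop)]
  simp only [integral_const_mul]
  rw [hval (by positivity), hval (by positivity), hval (by positivity), hval (by positivity),
    hval (by positivity), hval (by positivity), hval (by positivity), hval (by positivity),
    hval (by positivity)]
  have hsum : Real.exp (-((Real.sqrt (Ls + Lt) + Real.sqrt Ls + Real.sqrt Lt) / Real.sqrt 2)) =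
      Real.exp (-Real.sqrt (2 * ((Ls + Lt) / 4))) * A * B := by
    rw [← Real.exp_add, ← Real.exp_add, add_div, add_div, hdiv, hdiv, hdiv]
    ring_nf
  have hmix (u v : ℝ) : Real.exp (-u - v) = Real.exp (-u) * Real.exp (-v) := by
    rw [← Real.exp_add, sub_eq_add_neg]
  have hquarter (L : ℝ) : 2 * (L / 4) = L / 2 := by ring
  simp only [hsum, hmix, hdouble Ls, hdouble Lt, ← hA, ← hB, hquarter, mul_add, mul_zero,
    Real.sqrt_zero, neg_zero, Real.exp_zero, add_comm (2 * Lt) (Ls / 2)]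
  ring
end
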